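/- arXiv:2311.01087 — 2 statements merged into one kernel-verified Lean document; each statement's English description precedes it below -/
import Mathlib

section
/- Let V be a real vector space equipped with an alternating bilinear form ω, and let a, b, c, a', b' ∈ V satisfy ω(a, a') ≠ 0, ω(b, b') ≠ 0, ω(a, b') = 0 and ω(b, a') = 0. Then at least one of the following holds: (1) ω(c, a') ≠ 0 and ω(c, b') ≠ 0; (2) ω((1/2)(c + a), a') ≠ 0 and ω((1/2)(c + a), b') ≠ 0; (3) ω((1/2)(c + b), a') ≠ 0 and ω((1/2)(c + b), b') ≠ 0; (4) ω((1/3)(c + b + a), a') ≠ 0 and ω((1/3)(c + b + a), b') ≠ 0. -/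
/-- Lemma 5.3 of the paper: if `ω` is an alternating bilinear form on a real vector
space `V` and `a, b, c, a', b' ∈ V` satisfy `ω(a,a') ≠ 0`, `ω(b,b') ≠ 0`,
`ω(a,b') = 0` and `ω(b,a') = 0`, then one of four listed alternatives holds. -/
theorem four_cases_lemma
    {V : Type*} [AddCommGroup V] [Module ℝ V]
    (ω : V →ₗ[ℝ] V →ₗ[ℝ] ℝ) (halt : ∀ v : V, ω v v = 0)
    (a b c a' b' : V)
    (ha : ω a a' ≠ 0) (hb : ω b b' ≠ 0)
    (hab' : ω a b' = 0) (hba' : ω b a' = 0) :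
    (ω c a' ≠ 0 ∧ ω c b' ≠ 0) ∨
    (ω ((1/2 : ℝ) • (c + a)) a' ≠ 0 ∧ ω ((1/2 : ℝ) • (c + a)) b' ≠ 0) ∨
    (ω ((1/2 : ℝ) • (c + b)) a' ≠ 0 ∧ ω ((1/2 : ℝ) • (c + b)) b' ≠ 0) ∨
    (ω ((1/3 : ℝ) • (c + b + a)) a' ≠ 0 ∧ ω ((1/3 : ℝ) • (c + b + a)) b' ≠ 0) := by
  simp only [map_smul, map_add, LinearMap.smul_apply, LinearMap.add_apply, hab', hba', add_zero,
    smul_eq_mul]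
  by_cases h1 : ω c a' = 0 <;> by_cases h2 : ω c b' = 0
  · right; right; right
    simp [h1, h2, ha, hb]
  · right; left
    simp [h1, h2, ha]
  · right; right; left
    simp [h1, h2, hb]
  · left
    exact ⟨h1, h2⟩
end

section
/- Let d ≥ 1, let ω : ℝ^d × ℝ^d → ℝ be a bilinear form, let K ⊆ ℝ^d be a bounded set, and let v ∈ ℝ^d be a nonzero vector such that ω(ρ, v) = 0 for every ρ ∈ K. Then for every ε > 0 there exists a nonzero vector w ∈ ℤ^d such that |ω(ρ, w)| ≤ ε for every ρ ∈ K. -/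
/-- The Dirichlet approximation argument of the second case of Section 5: if a bounded
set `K ⊆ ℝ^d` pairs trivially, for a bilinear form `ω`, with some nonzero vector `v`,
then for every `ε > 0` there is a nonzero integer vector `w` with `|ω(ρ, w)| ≤ ε` for
all `ρ ∈ K`. -/
theorem integer_vector_almost_orthogonal
    (d : ℕ) (hd : 1 ≤ d)
    (ω : (Fin d → ℝ) →ₗ[ℝ] (Fin d → ℝ) →ₗ[ℝ] ℝ)
    (K : Set (Fin d → ℝ)) (hK : Bornology.IsBounded K)
    (v : Fin d → ℝ) (hv : v ≠ 0)
    (horth : ∀ ρ ∈ K, ω ρ v = 0) :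
    ∀ ε > 0, ∃ w : Fin d → ℤ, w ≠ 0 ∧
      ∀ ρ ∈ K, |ω ρ (fun i => (w i : ℝ))| ≤ ε := by
  intro ε hε
  obtain ⟨R, hR⟩ := hK.exists_norm_le
  let L : (Fin d → ℝ) →L[ℝ] (Fin d → ℝ) →L[ℝ] ℝ :=
    LinearMap.toContinuousLinearMap
      ((LinearMap.toContinuousLinearMap : _ ≃ₗ[ℝ] ((Fin d → ℝ) →L[ℝ] ℝ)).toLinearMap ∘ₗ ω)
  have hL : ∀ ρ x, |ω ρ x| ≤ ‖L‖ * ‖ρ‖ * ‖x‖ := fun ρ x => L.le_opNorm₂ ρ x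
  set C : ℝ := ‖L‖ * |R| with hC
  have hC0 : 0 ≤ C := by positivity
  have hb : ∀ ρ ∈ K, ∀ x, |ω ρ x| ≤ C * ‖x‖ := by
    intro ρ hρ x
    refine (hL ρ x).trans ?_
    have := (hR ρ hρ).trans (le_abs_self R)
    rw [hC]
    gcongr
  obtain ⟨i₀, hi₀⟩ := Function.ne_iff.mp hv
  have hi₀ : v i₀ ≠ 0 := hi₀
  let u : Fin d → ℝ := (v i₀)⁻¹ • v
  have hu1 : u i₀ = 1 := by simp [u, hi₀]
  have hu : ∀ ρ ∈ K, ω ρ u = 0 := by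
    intro ρ hρ
    simp [u, horth ρ hρ]
  obtain ⟨N, hN⟩ := exists_nat_gt (C / ε)
  have hN0 : (0 : ℝ) < N := lt_of_le_of_lt (by positivity) hN
  have hlt : ∀ (n : ℕ) (i : Fin d), ⌊(N : ℝ) * Int.fract ((n : ℝ) * u i)⌋₊ < N := by
    intro n i
    rw [Nat.floor_lt (mul_nonneg hN0.le (Int.fract_nonneg _))]
    nlinarith [Int.fract_lt_one ((n : ℝ) * u i)]
  let f : ℕ → Fin d → Fin N := fun n i => ⟨_, hlt n i⟩
  obtain ⟨m, n, hmn, hf⟩ := Finite.exists_ne_map_eq_of_infinite f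
  let w : Fin d → ℤ := fun i => ⌊(m : ℝ) * u i⌋ - ⌊(n : ℝ) * u i⌋
  refine ⟨w, ?_, ?_⟩
  · intro h
    have h1 := congrFun h i₀
    simp [w, hu1] at h1
    omega
  · intro ρ hρ
    let e : Fin d → ℝ := fun i => Int.fract ((n : ℝ) * u i) - Int.fract ((m : ℝ) * u i)
    have hw : (fun i => (w i : ℝ)) = ((m : ℝ) - n) • u + e := by
      funext i
      simp only [w, e, Int.fract, Pi.add_apply, Pi.smul_apply, smul_eq_mul]
      push_cast
      ring
    have he : ‖e‖ ≤ 1 / N := by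
      rw [pi_norm_le_iff_of_nonneg (by positivity)]
      intro i
      have h1 : ⌊(N : ℝ) * Int.fract ((m : ℝ) * u i)⌋₊ = ⌊(N : ℝ) * Int.fract ((n : ℝ) * u i)⌋₊ :=
        congrArg Fin.val (congrFun hf i)
      have a1 := Nat.floor_le (mul_nonneg hN0.le (Int.fract_nonneg ((m : ℝ) * u i)))
      have a2 := Nat.lt_floor_add_one ((N : ℝ) * Int.fract ((m : ℝ) * u i))
      have b1 := Nat.floor_le (mul_nonneg hN0.le (Int.fract_nonneg ((n : ℝ) * u i)))
      have b2 := Nat.lt_floor_add_one ((N : ℝ) * Int.fract ((n : ℝ) * u i))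
      rw [h1] at a1 a2
      rw [Real.norm_eq_abs, le_div_iff₀ hN0, ← abs_of_pos hN0, ← abs_mul, abs_le]
      simp only [e, abs_of_pos hN0]
      constructor <;> linarith
    rw [hw, map_add, map_smul, hu ρ hρ, smul_zero, zero_add]
    calc |ω ρ e| ≤ C * ‖e‖ := hb ρ hρ e
      _ ≤ C * (1 / N) := by gcongr
      _ ≤ ε := by
        rw [mul_one_div, div_le_iff₀ hN0]
        rw [div_lt_iff₀ hε] at hN
        linarith
end
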